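/- Let μ be a measure (finitely supported, nonnegative) on ℤ × ℤ with (D₀μ)(Γ) ≠ 0. Then Cov_{D₀μ}(a, a−b) = Var_{D₀μ}(a−b) and Cov_{D₀μ}(b, a−b) = 0. -/

import Mathlib

open Finsupp Filter

noncomputable section

/-- Signed-sum convention: `signedSum c k = Σ_{i=0}^{k} c i`, which is the ordinary sum for
`k ≥ 0`, is `0` for `k = -1`, and equals `-(c (-1) + c (-2) + ⋯ + c (k+1))` for `k ≤ -2`. -/
def signedSum {M : Type*} [AddCommGroup M] (c : ℤ → M) (k : ℤ) : M :=
  (∑ i ∈ Finset.range (k + 1).toNat, c i) -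
    ∑ i ∈ Finset.range (-(k + 1)).toNat, c (-((i : ℤ) + 1))

/-- The Demazure operator `D₀` (relative to `Λ = mΛ₀ + nΛ₁`):
`D₀ δ_{(a,b)} = Σ_{i=0}^{m - 2(a-b)} δ_{(a+i,b)}`, extended ℤ-linearly. -/
def D0 (m : ℕ) (μ : ℤ × ℤ →₀ ℤ) : ℤ × ℤ →₀ ℤ :=
  μ.sum fun p c =>
    c • signedSum (fun i => Finsupp.single (p.1 + i, p.2) (1 : ℤ)) ((m : ℤ) - 2 * (p.1 - p.2))

/-- The Demazure operator `D₁` (relative to `Λ = mΛ₀ + nΛ₁`):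
`D₁ δ_{(a,b)} = Σ_{i=0}^{n + 2(a-b)} δ_{(a,b+i)}`, extended ℤ-linearly. -/
def D1 (n : ℕ) (μ : ℤ × ℤ →₀ ℤ) : ℤ × ℤ →₀ ℤ :=
  μ.sum fun p c =>
    c • signedSum (fun i => Finsupp.single (p.1, p.2 + i) (1 : ℤ)) ((n : ℤ) + 2 * (p.1 - p.2))

/-- Total mass `μ(Γ)` of a finitely supported function on `ℤ × ℤ`. -/
def mass (μ : ℤ × ℤ →₀ ℤ) : ℤ := μ.sum fun _ c => c

/-- Expected value `E_ν[f] = (1/ν(Γ)) Σ ν(a,b) f(a,b)`. -/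
def expVal (ν : ℤ × ℤ →₀ ℤ) (f : ℤ × ℤ → ℚ) : ℚ :=
  (mass ν : ℚ)⁻¹ * ν.sum fun p c => (c : ℚ) * f p

/-- Covariance `Cov_ν(f,g) = E_ν[f·g] - E_ν[f]·E_ν[g]`. -/
def cov (ν : ℤ × ℤ →₀ ℤ) (f g : ℤ × ℤ → ℚ) : ℚ :=
  expVal ν (fun p => f p * g p) - expVal ν f * expVal ν g

/-- Variance `Var_ν(f) = Cov_ν(f,f)`. -/
def var (ν : ℤ × ℤ →₀ ℤ) (f : ℤ × ℤ → ℚ) : ℚ := cov ν f f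

/-- The coordinate function `a` (the degree). -/
def fa : ℤ × ℤ → ℚ := fun p => (p.1 : ℚ)

/-- The coordinate function `b`. -/
def fb : ℤ × ℤ → ℚ := fun p => (p.2 : ℚ)

/-- The finite-weight coordinate `a - b`. -/
def fab : ℤ × ℤ → ℚ := fun p => (p.1 : ℚ) - (p.2 : ℚ)

/-- `μ_{N,0}`: start from `δ_{(0,0)}`, apply `D₀` at odd steps and `D₁` at even steps. -/
def mu0 (m n : ℕ) : ℕ → (ℤ × ℤ →₀ ℤ)
  | 0 => Finsupp.single (0, 0) 1
  | N + 1 => if N % 2 = 0 then D0 m (mu0 m n N) else D1 n (mu0 m n N)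

/-- `μ_{N,1}`: start from `δ_{(0,0)}`, apply `D₁` at odd steps and `D₀` at even steps. -/
def mu1 (m n : ℕ) : ℕ → (ℤ × ℤ →₀ ℤ)
  | 0 => Finsupp.single (0, 0) 1
  | N + 1 => if N % 2 = 0 then D1 n (mu1 m n N) else D0 m (mu1 m n N)

theorem map_signedSum {M N : Type*} [AddCommGroup M] [AddCommGroup N] (φ : M →+ N)
    (c : ℤ → M) (k : ℤ) : φ (signedSum c k) = signedSum (fun i => φ (c i)) k := by
  simp [signedSum, map_sub, map_sum]

theorem sum_range_two_mul_sub (x : ℚ) (n : ℕ) :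
    ∑ i ∈ Finset.range n, (2 * (i : ℚ) - x) = n * (n - 1 - x) := by
  induction n with
  | zero => simp
  | succ n ih => rw [Finset.sum_range_succ, ih]; push_cast; ring

/-- The midpoint of the summation range is the mean of the index, also for signed sums. -/
theorem signedSum_mul_two_mul_sub (r : ℚ) (k : ℤ) :
    signedSum (fun i => r * (2 * (i : ℚ) - k)) k = 0 := by
  unfold signedSum
  obtain ⟨n, hn | hn⟩ := Int.eq_nat_or_neg (k + 1)
  · obtain rfl : k = n - 1 := by omega
    have h₂ : (-((n : ℤ) - 1 + 1)).toNat = 0 := by omega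
    have h₁ : ((n : ℤ) - 1 + 1).toNat = n := by omega
    rw [h₁, h₂, ← Finset.mul_sum]
    push_cast
    rw [sum_range_two_mul_sub]
    simp
  · obtain rfl : k = -n - 1 := by omega
    have h₁ : (-(n : ℤ) - 1 + 1).toNat = 0 := by omega
    have h₂ : (-(-(n : ℤ) - 1 + 1)).toNat = n := by omega
    have h₃ : ∀ i : ℕ, 2 * (((-((i : ℤ) + 1) : ℤ)) : ℚ) - ((-n - 1 : ℤ) : ℚ)
        = -(2 * (i : ℚ) - (n - 1)) := by
      intro i; push_cast; ring
    simp only [h₁, h₂, h₃]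
    rw [← Finset.mul_sum, ← Finset.mul_sum, Finset.sum_neg_distrib, sum_range_two_mul_sub]
    simp

theorem linearCombination_D0_eq_zero (m : ℕ) (μ : ℤ × ℤ →₀ ℤ) (g : ℤ → ℚ) :
    Finsupp.linearCombination ℤ
      (fun p : ℤ × ℤ => g p.2 * (2 * ((p.1 : ℚ) - p.2) - m)) (D0 m μ) = 0 := by
  rw [D0, map_finsuppSum]
  refine Finset.sum_eq_zero fun p _ => ?_
  beta_reduce
  rw [map_smul, ← LinearMap.toAddMonoidHom_coe, map_signedSum]
  have h : (fun i : ℤ => (Finsupp.linearCombination ℤ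
      (fun p : ℤ × ℤ => g p.2 * (2 * ((p.1 : ℚ) - p.2) - m))).toAddMonoidHom
        (Finsupp.single (p.1 + i, p.2) (1 : ℤ)))
      = fun i : ℤ => g p.2 * (2 * (i : ℚ) - (((m : ℤ) - 2 * (p.1 - p.2) : ℤ) : ℚ)) := by
    funext i
    simp only [LinearMap.toAddMonoidHom_coe, Finsupp.linearCombination_single, one_smul]
    push_cast
    ring
  rw [h, signedSum_mul_two_mul_sub, smul_zero]

theorem expVal_add (ν : ℤ × ℤ →₀ ℤ) (f g : ℤ × ℤ → ℚ) :
    expVal ν (fun p => f p + g p) = expVal ν f + expVal ν g := by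
  simp only [expVal, mul_add, Finsupp.sum_add]

theorem expVal_const_mul (ν : ℤ × ℤ →₀ ℤ) (r : ℚ) (f : ℤ × ℤ → ℚ) :
    expVal ν (fun p => r * f p) = r * expVal ν f := by
  simp only [expVal, Finsupp.sum, Finset.mul_sum]
  exact Finset.sum_congr rfl fun _ _ => by ring

theorem expVal_one {ν : ℤ × ℤ →₀ ℤ} (h : mass ν ≠ 0) : expVal ν (fun _ => 1) = 1 := by
  have hs : (ν.sum fun _ c => (c : ℚ) * 1) = mass ν := by simp [mass, Finsupp.sum]
  rw [expVal, hs, inv_mul_cancel₀ (Int.cast_ne_zero.mpr h)]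

/-- Against any function of `b`, the coordinate `a - b` averages to `m / 2` under `D₀ μ`. -/
theorem expVal_D0_mul_fab (m : ℕ) (μ : ℤ × ℤ →₀ ℤ) (g : ℤ → ℚ) :
    expVal (D0 m μ) (fun p => g p.2 * fab p) = m / 2 * expVal (D0 m μ) (fun p => g p.2) := by
  have h : expVal (D0 m μ) (fun p => g p.2 * (2 * ((p.1 : ℚ) - p.2) - m)) = 0 := by
    have := linearCombination_D0_eq_zero m μ g
    rw [Finsupp.linearCombination_apply] at this
    simp only [zsmul_eq_mul] at this
    rw [expVal, this, mul_zero]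
  have hsplit : (fun p : ℤ × ℤ => g p.2 * (2 * ((p.1 : ℚ) - p.2) - m))
      = fun p => 2 * (g p.2 * fab p) + -(m : ℚ) * g p.2 := by
    funext p; simp only [fab]; ring
  rw [hsplit, expVal_add, expVal_const_mul, expVal_const_mul] at h
  linarith

theorem cov_add_left (ν : ℤ × ℤ →₀ ℤ) (f₁ f₂ g : ℤ × ℤ → ℚ) :
    cov ν (fun p => f₁ p + f₂ p) g = cov ν f₁ g + cov ν f₂ g := by
  simp only [cov, add_mul, expVal_add]
  ring

/-- `Cov_{D₀μ}(a, a-b) = Var_{D₀μ}(a-b)` and `Cov_{D₀μ}(b, a-b) = 0`. -/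
theorem stmt_9 (m : ℕ) (μ : ℤ × ℤ →₀ ℤ) (hpos : ∀ p, 0 ≤ μ p)
    (h : mass (D0 m μ) ≠ 0) :
    cov (D0 m μ) fa fab = var (D0 m μ) fab ∧ cov (D0 m μ) fb fab = 0 := by
  have hb : cov (D0 m μ) fb fab = 0 := by
    have h₁ := expVal_D0_mul_fab m μ (fun b => (b : ℚ))
    have h₂ := expVal_D0_mul_fab m μ (fun _ => 1)
    simp only [one_mul] at h₂
    rw [expVal_one h, mul_one] at h₂
    change expVal (D0 m μ) (fun p => (p.2 : ℚ) * fab p)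
      - expVal (D0 m μ) (fun p => (p.2 : ℚ)) * expVal (D0 m μ) (fun p => fab p) = 0
    rw [h₁, h₂]
    ring
  refine ⟨?_, hb⟩
  have ha : fa = fun p => fab p + fb p := by
    funext p; simp [fa, fab, fb]
  rw [ha, cov_add_left, hb, add_zero, var]
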